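/- arXiv:1809.09276 — 2 statements merged into one kernel-verified Lean document; each statement's English description precedes it below -/
import Mathlib

section
/- Fix α ∈ (0,1). Then for every real t > 0: lim_{n→∞} ∑_{i=2}^{n} (-1)^i ([-iα]_{(n,1)} / [-α]_{(n,1)}) · (Γ(n-i+1, t) / (n-i)!) · t^i / i! = 0, where Γ(a,x) := ∫_x^∞ u^{a-1} e^{-u} du is the upper incomplete gamma function. -/
open Real Filter
open scoped BigOperators Topology

/-- Rising factorial `[x]_{(n,a)} = ∏_{i=0}^{n-1} (x + i a)`. -/
noncomputable def risingFac (x : ℝ) (n : ℕ) (a : ℝ) : ℝ :=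
  ∏ i ∈ Finset.range n, (x + i * a)

/-- Upper incomplete gamma function `Γ(a,x) = ∫_x^∞ u^{a-1} e^{-u} du`. -/
noncomputable def upperGamma (a x : ℝ) : ℝ :=
  ∫ u in Set.Ioi x, u ^ (a - 1) * Real.exp (-u)

lemma upperGamma_nonneg (a : ℝ) {x : ℝ} (hx : 0 ≤ x) : 0 ≤ upperGamma a x :=
  MeasureTheory.setIntegral_nonneg measurableSet_Ioi fun _ hu =>
    mul_nonneg (rpow_nonneg (hx.trans (Set.mem_Ioi.mp hu).le) _) (exp_pos _).le

lemma upperGamma_le_Gamma {a x : ℝ} (ha : 0 < a) (hx : 0 ≤ x) : upperGamma a x ≤ Gamma a := by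
  rw [Gamma_eq_integral ha, upperGamma]
  simp_rw [mul_comm _ (Real.exp _)]
  refine MeasureTheory.setIntegral_mono_set (GammaIntegral_convergent ha) ?_
    (Set.Ioi_subset_Ioi hx).eventuallyLE
  filter_upwards [MeasureTheory.ae_restrict_mem measurableSet_Ioi] with u hu
  exact mul_nonneg (exp_pos _).le (rpow_nonneg (Set.mem_Ioi.mp hu).le _)

lemma abs_upperGamma_div_factorial_le_one {n i : ℕ} (hin : i ≤ n) {t : ℝ} (ht : 0 ≤ t) :
    |upperGamma ((n : ℝ) - i + 1) t / (Nat.factorial (n - i) : ℝ)| ≤ 1 := by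
  have hcast : (n : ℝ) - i + 1 = ((n - i : ℕ) : ℝ) + 1 := by rw [Nat.cast_sub hin]
  rw [hcast, abs_of_nonneg (div_nonneg (upperGamma_nonneg _ ht) (Nat.cast_nonneg _))]
  refine div_le_one_of_le₀ ?_ (Nat.cast_nonneg _)
  rw [← Gamma_nat_eq_factorial]
  exact upperGamma_le_Gamma (by positivity) ht

lemma abs_risingFac_div (x y : ℝ) (n : ℕ) :
    |risingFac x n 1 / risingFac y n 1| =
      ∏ j ∈ Finset.range n, (|x + j| / |y + j|) := by
  simp [risingFac, abs_div, Finset.abs_prod, Finset.prod_div_distrib]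

/-- Past the zero of the numerator, the factors of the ratio decay like `exp (-α / (j + 1))`. -/
lemma abs_factor_div_le_exp {α : ℝ} (hα : α ∈ Set.Ioo (0 : ℝ) 1) {i j : ℕ} (hi : 2 ≤ i)
    (hj : (i : ℝ) * α ≤ j) :
    |-(i : ℝ) * α + j| / |-α + j| ≤ Real.exp (-α * (1 / ((j : ℝ) + 1))) := by
  obtain ⟨h0, h1⟩ := hα
  have hi' : (2 : ℝ) ≤ i := by exact_mod_cast hi
  have hpos : 0 < -α + (j : ℝ) := by nlinarith
  rw [abs_of_nonneg (by linarith), abs_of_pos hpos]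
  have hstep : (-(i : ℝ) * α + j) / (-α + j) ≤ -α * (1 / ((j : ℝ) + 1)) + 1 := by
    rw [div_le_iff₀ hpos]
    have : α * (1 / ((j : ℝ) + 1)) * (-α + j) ≤ α := by
      rw [mul_one_div, div_mul_eq_mul_div, div_le_iff₀ (by positivity)]
      nlinarith
    nlinarith
  exact hstep.trans (add_one_le_exp _)

lemma tendsto_risingFac_div {α : ℝ} (hα : α ∈ Set.Ioo (0 : ℝ) 1) {i : ℕ} (hi : 2 ≤ i) :
    Tendsto (fun n : ℕ => risingFac (-(i : ℝ) * α) n 1 / risingFac (-α) n 1) atTop (𝓝 0) := by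
  rw [tendsto_zero_iff_abs_tendsto_zero]
  change Tendsto (fun n : ℕ => |risingFac (-(i : ℝ) * α) n 1 / risingFac (-α) n 1|) atTop (𝓝 0)
  simp_rw [abs_risingFac_div]
  obtain ⟨N, hN⟩ := exists_nat_ge ((i : ℝ) * α)
  set S : ℕ → ℝ := fun n => ∑ j ∈ Finset.range n, 1 / ((j : ℝ) + 1) with hS
  set P : ℕ → ℝ := fun n => ∏ j ∈ Finset.range n, (|-(i : ℝ) * α + j| / |-α + j|) with hP
  have hbound : ∀ n, N ≤ n → P n ≤ P N * Real.exp (α * S N) * Real.exp (-α * S n) := by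
    intro n hn
    induction n, hn using Nat.le_induction with
    | base => rw [mul_assoc, ← Real.exp_add]; simp
    | succ n hn ih =>
      have hf := abs_factor_div_le_exp hα hi (hN.trans (Nat.cast_le.mpr hn))
      have hPs : P (n + 1) = P n * (|-(i : ℝ) * α + n| / |-α + n|) := Finset.prod_range_succ _ _
      have hSs : S (n + 1) = S n + 1 / ((n : ℝ) + 1) := Finset.sum_range_succ _ _
      rw [hPs, hSs, mul_add, Real.exp_add, ← mul_assoc]
      exact mul_le_mul ih hf (by positivity)
        (mul_nonneg (mul_nonneg (Finset.prod_nonneg fun _ _ => by positivity) (exp_pos _).le)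
          (exp_pos _).le)
  have hexp : Tendsto (fun n => Real.exp (-α * S n)) atTop (𝓝 0) :=
    tendsto_exp_atBot.comp
      (tendsto_sum_range_one_div_nat_succ_atTop.const_mul_atTop_of_neg (neg_lt_zero.mpr hα.1))
  have hlim := hexp.const_mul (P N * Real.exp (α * S N))
  rw [mul_zero] at hlim
  refine squeeze_zero' (Eventually.of_forall fun n => Finset.prod_nonneg fun _ _ => by positivity)
    ?_ hlim
  filter_upwards [eventually_ge_atTop N] with n hn using hbound n hn

lemma prod_abs_factor_div_le_pow {α x : ℝ} (hα : α ∈ Set.Ioo (0 : ℝ) 1) {m : ℕ}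
    (hm : (m : ℝ) ≤ x) (hx : x ≤ m + 1) :
    ∏ j ∈ Finset.range m, (|-x + (j + 1 : ℕ)| / |-α + (j + 1 : ℕ)|) ≤ (1 / (1 - α)) ^ m := by
  obtain ⟨h0, h1⟩ := hα
  have hnum : ∏ j ∈ Finset.range m, |-x + (j + 1 : ℕ)| ≤
      ∏ j ∈ Finset.range m, ((j : ℝ) + 1) := by
    rw [← Finset.prod_range_reflect (fun j : ℕ => (j : ℝ) + 1)]
    refine Finset.prod_le_prod (fun _ _ => abs_nonneg _) fun j hj => ?_
    have hjm : j + 1 ≤ m := Finset.mem_range.mp hj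
    have hcast : ((m - 1 - j : ℕ) : ℝ) = m - 1 - j := by
      rw [Nat.sub_sub, Nat.cast_sub (by omega)]; push_cast; ring
    have : ((j + 1 : ℕ) : ℝ) ≤ m := Nat.cast_le.mpr hjm
    rw [hcast, abs_of_nonpos (by linarith)]
    push_cast
    linarith
  rw [Finset.prod_div_distrib]
  have hden : ∀ j : ℕ, 0 < |-α + (j + 1 : ℕ)| := fun j => by
    rw [abs_pos]; push_cast; have : (0 : ℝ) ≤ j := j.cast_nonneg
    linarith
  refine (div_le_div_of_nonneg_right hnum (Finset.prod_nonneg fun j _ => (hden j).le)).trans ?_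
  rw [← Finset.prod_div_distrib]
  calc _ ≤ ∏ _j ∈ Finset.range m, (1 / (1 - α)) := by
        refine Finset.prod_le_prod (fun j _ => by positivity) fun j _ => ?_
        have hj : (0 : ℝ) ≤ j := j.cast_nonneg
        rw [div_le_div_iff₀ (hden j) (by linarith), abs_of_pos (by push_cast; linarith)]
        push_cast
        nlinarith
    _ = _ := by simp

lemma abs_risingFac_div_le {α : ℝ} (hα : α ∈ Set.Ioo (0 : ℝ) 1) {i n : ℕ} (hi : 2 ≤ i)
    (hin : i ≤ n) :
    |risingFac (-(i : ℝ) * α) n 1 / risingFac (-α) n 1| ≤ (2 / (1 - α)) ^ i := by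
  rw [abs_risingFac_div]
  have h0 := hα.1
  have h1 := hα.2
  have hi0 : (0 : ℝ) < i := by positivity
  set m := ⌊(i : ℝ) * α⌋₊ with hmdef
  have hm : (m : ℝ) ≤ i * α := Nat.floor_le (by positivity)
  have hm' : (i : ℝ) * α < m + 1 := Nat.lt_floor_add_one _
  have hmi : m < i := by
    have : (m : ℝ) < i := hm.trans_lt (by nlinarith)
    exact_mod_cast this
  have hinv : 1 ≤ 1 / (1 - α) := by rw [le_div_iff₀ (by linarith)]; linarith
  rw [← Finset.prod_range_mul_prod_Ico _ (show m + 1 ≤ n by omega), Finset.prod_range_succ']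
  have htail : ∏ j ∈ Finset.Ico (m + 1) n, (|-(i : ℝ) * α + j| / |-α + j|) ≤ 1 := by
    refine Finset.prod_le_one (fun _ _ => by positivity) fun j hj => ?_
    have hj : ((m + 1 : ℕ) : ℝ) ≤ j := Nat.cast_le.mpr (Finset.mem_Ico.mp hj).1
    push_cast at hj
    refine (abs_factor_div_le_exp hα hi (by linarith)).trans (exp_le_one_iff.mpr ?_)
    have : 0 < α * (1 / ((j : ℝ) + 1)) := by positivity
    linarith
  have hhead := prod_abs_factor_div_le_pow hα hm hm'.le
  simp_rw [neg_mul] at htail ⊢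
  have hzero : |-((i : ℝ) * α) + (0 : ℕ)| / |-α + (0 : ℕ)| = i := by
    rw [Nat.cast_zero, add_zero, add_zero, abs_neg, abs_neg, abs_mul, abs_of_pos h0,
      abs_of_pos hi0, mul_div_assoc, div_self h0.ne', mul_one]
  rw [hzero]
  have hi2 : (i : ℝ) ≤ 2 ^ i := by exact_mod_cast Nat.lt_two_pow_self.le
  calc _ ≤ (1 / (1 - α)) ^ m * i * 1 :=
        mul_le_mul (mul_le_mul_of_nonneg_right hhead hi0.le) htail
          (Finset.prod_nonneg fun _ _ => by positivity) (by positivity)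
    _ ≤ (1 / (1 - α)) ^ i * 2 ^ i := by
        rw [mul_one]
        exact mul_le_mul (pow_le_pow_right₀ hinv hmi.le) hi2 hi0.le (by positivity)
    _ = _ := by rw [← mul_pow]; congr 1; ring

theorem stmt7 (α : ℝ) (hα : α ∈ Set.Ioo (0 : ℝ) 1) (t : ℝ) (ht : 0 < t) :
    Tendsto (fun n : ℕ =>
        ∑ i ∈ Finset.Icc 2 n, (-1 : ℝ) ^ i *
          (risingFac (-(i : ℝ) * α) n 1 / risingFac (-α) n 1) *
          (upperGamma ((n : ℝ) - i + 1) t / (Nat.factorial (n - i) : ℝ)) *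
          t ^ i / (Nat.factorial i : ℝ))
      atTop (𝓝 0) := by
  set f : ℕ → ℕ → ℝ := fun n i => (-1 : ℝ) ^ i *
          (risingFac (-(i : ℝ) * α) n 1 / risingFac (-α) n 1) *
          (upperGamma ((n : ℝ) - i + 1) t / (Nat.factorial (n - i) : ℝ)) *
          t ^ i / (Nat.factorial i : ℝ) with hf
  have hfle : ∀ {n i : ℕ}, i ≤ n →
      |f n i| ≤ |risingFac (-(i : ℝ) * α) n 1 / risingFac (-α) n 1| *
        (t ^ i / (Nat.factorial i : ℝ)) := by
    intro n i hin
    have hq := abs_upperGamma_div_factorial_le_one hin ht.le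
    have hc : (0 : ℝ) ≤ t ^ i / (Nat.factorial i : ℝ) := by positivity
    simp only [hf]
    rw [mul_div_assoc, abs_mul, abs_mul, abs_mul, abs_pow, abs_neg, abs_one, one_pow, one_mul,
      abs_of_nonneg hc]
    exact mul_le_mul_of_nonneg_right (mul_le_of_le_one_right (abs_nonneg _) hq) hc
  have hsum : ∀ n, ∑ i ∈ Finset.Icc 2 n, f n i =
      ∑' i, (Finset.Icc 2 n : Set ℕ).indicator (f n) i := fun n => by
    rw [← sum_eq_tsum_indicator]
  change Tendsto (fun n => ∑ i ∈ Finset.Icc 2 n, f n i) atTop (𝓝 0)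
  simp_rw [hsum]
  rw [← tsum_zero (α := ℝ) (β := ℕ)]
  have h1 : 0 < 1 - α := by linarith [hα.2]
  refine tendsto_tsum_of_dominated_convergence
    (bound := fun i => (2 / (1 - α) * t) ^ i / (Nat.factorial i : ℝ))
    (summable_pow_div_factorial _) (fun i => ?_) (Eventually.of_forall fun n i => ?_)
  · by_cases hi : 2 ≤ i
    · have hlim := (tendsto_risingFac_div hα hi).abs.mul_const (t ^ i / (Nat.factorial i : ℝ))
      rw [abs_zero, zero_mul] at hlim
      refine squeeze_zero_norm' ?_ hlim
      filter_upwards [eventually_ge_atTop i] with n hn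
      rw [Set.indicator_of_mem (by simp [hi, hn])]
      exact hfle hn
    · simp [hi]
  · by_cases hi : i ∈ (Finset.Icc 2 n : Set ℕ)
    · rw [Set.indicator_of_mem hi, norm_eq_abs]
      have hi' := Finset.mem_Icc.mp (Finset.mem_coe.mp hi)
      refine (hfle hi'.2).trans ?_
      rw [mul_pow, mul_div_assoc]
      exact mul_le_mul_of_nonneg_right (abs_risingFac_div_le hα hi'.1 hi'.2) (by positivity)
    · rw [Set.indicator_of_notMem hi, norm_zero]
      positivity
end

section
/- Let α ∈ (0,1), θ > -α, and let n, j, m be positive integers with 1 ≤ j ≤ n. For 0 ≤ k ≤ m define the posterior probabilities p(k) := ([θ/α + j]_{(k,1)} / [θ+n]_{(m,1)}) · 𝒞(m,k; α, -n+jα), and for 1 ≤ l ≤ m define q(l) := ([θ+n]_{(l,α)} / [θ+n]_{(m,1)}) · 𝒞(m,l;α) / α^l. Then for every k ∈ {0,…,m}: p(k) = ∑_{l=1}^{m} q(l) · binom(l,k) · B(θ/α + j + k, n/α − j + l − k) / B(θ/α + j, n/α − j), where B(a,b) = Γ(a)Γ(b)/Γ(a+b) is the Beta function and binom(l,k) :=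 0 when k > l. In probabilistic terms: if K_m^{(n)} has the posterior distribution p(·) of the number of new blocks in m additional samples from PD(α,θ) given K_n = j, if K*_m has distribution q(·) (the law of the number of blocks of a sample of size m from PD(α,θ+n)), and if B is a Beta(θ/α+j, n/α−j) random variable independent of K*_m, then K_m^{(n)} is distributed as a Binomial with K*_m trials and random success probability B. -/
open Real
open scoped BigOperators

/-- Generalized factorial coefficient
`𝒞(m,k;α) = (1/k!) ∑_{i=1}^{k} (-1)^i C(k,i) [-iα]_{(m,1)}`. -/
noncomputable def genFacCoeff (m k : ℕ) (α : ℝ) : ℝ :=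
  (1 / (Nat.factorial k : ℝ)) *
    ∑ i ∈ Finset.Icc 1 k, (-1 : ℝ) ^ i * (Nat.choose k i : ℝ) * risingFac (-(i : ℝ) * α) m 1

/-- Non-central generalized factorial coefficient
`𝒞(m,k;s,r) = (1/k!) ∑_{i=0}^{k} (-1)^i C(k,i) [-is-r]_{(m,1)}`. -/
noncomputable def ncGenFacCoeff (m k : ℕ) (s r : ℝ) : ℝ :=
  (1 / (Nat.factorial k : ℝ)) *
    ∑ i ∈ Finset.range (k + 1),
      (-1 : ℝ) ^ i * (Nat.choose k i : ℝ) * risingFac (-(i : ℝ) * s - r) m 1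

/-- The Beta function `B(a,b) = Γ(a)Γ(b)/Γ(a+b)`. -/
noncomputable def betaFn (a b : ℝ) : ℝ :=
  Real.Gamma a * Real.Gamma b / Real.Gamma (a + b)

theorem risingFac_succ (x : ℝ) (n : ℕ) (a : ℝ) :
    risingFac x (n + 1) a = risingFac x n a * (x + n * a) :=
  Finset.prod_range_succ _ _

theorem risingFac_zero_right (x a : ℝ) : risingFac x 0 a = 1 :=
  Finset.prod_range_zero _

theorem risingFac_succ' (x : ℝ) (n : ℕ) (a : ℝ) :
    risingFac x (n + 1) a = x * risingFac (x + a) n a := by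
  unfold risingFac
  rw [Finset.prod_range_succ', mul_comm]
  congr 1
  · simp
  · refine Finset.prod_congr rfl fun i _ => ?_
    push_cast
    ring

theorem risingFac_zero_left {n : ℕ} (hn : n ≠ 0) (a : ℝ) : risingFac 0 n a = 0 := by
  obtain ⟨n, rfl⟩ := Nat.exists_eq_succ_of_ne_zero hn
  rw [Nat.succ_eq_add_one, risingFac_succ', zero_mul]

theorem risingFac_mul_left (c x : ℝ) (n : ℕ) (a : ℝ) :
    risingFac (c * x) n (c * a) = c ^ n * risingFac x n a := by
  induction n with
  | zero => simp [risingFac_zero_right]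
  | succ n ih => rw [risingFac_succ, risingFac_succ, ih]; ring

theorem risingFac_one_pos {x : ℝ} (hx : 0 < x) (n : ℕ) : 0 < risingFac x n 1 :=
  Finset.prod_pos fun i _ => by positivity

theorem Gamma_add_natCast_eq_risingFac_mul {x : ℝ} (hx : 0 < x) (n : ℕ) :
    Real.Gamma (x + n) = risingFac x n 1 * Real.Gamma x := by
  induction n with
  | zero => simp [risingFac_zero_right]
  | succ n ih =>
    have h : x + n ≠ 0 := by positivity
    rw [Nat.cast_succ, ← add_assoc, Real.Gamma_add_one h, ih, risingFac_succ]
    ring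

theorem betaFn_add_natCast_div {a b : ℝ} (ha : 0 < a) (hb : 0 < b) (k d : ℕ) :
    betaFn (a + k) (b + d) / betaFn a b =
      risingFac a k 1 * risingFac b d 1 / risingFac (a + b) (k + d) 1 := by
  have hab : 0 < a + b := add_pos ha hb
  have hsum : a + k + (b + d) = a + b + ((k + d : ℕ) : ℝ) := by push_cast; ring
  unfold betaFn
  rw [hsum, Gamma_add_natCast_eq_risingFac_mul ha, Gamma_add_natCast_eq_risingFac_mul hb,
    Gamma_add_natCast_eq_risingFac_mul hab]
  have h₁ := (Real.Gamma_pos_of_pos ha).ne'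
  have h₂ := (Real.Gamma_pos_of_pos hb).ne'
  have h₃ := (Real.Gamma_pos_of_pos hab).ne'
  have h₄ := (risingFac_one_pos hab (k + d)).ne'
  field_simp

/-- The backward difference lowers the degree of a rising factorial. -/
theorem risingFac_sub_risingFac_sub_one (x : ℝ) (n : ℕ) :
    risingFac x n 1 - risingFac (x - 1) n 1 = n * risingFac x (n - 1) 1 := by
  cases n with
  | zero => simp [risingFac_zero_right]
  | succ n =>
    rw [risingFac_succ, risingFac_succ', sub_add_cancel, Nat.add_sub_cancel]
    push_cast
    ring

theorem fwdDiff_iter_risingFac (n k : ℕ) :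
    (fwdDiff (-1 : ℝ))^[k] (fun x => risingFac x n 1) =
      fun x => (-1) ^ k * (n.descFactorial k : ℝ) * risingFac x (n - k) 1 := by
  induction k with
  | zero => simp
  | succ k ih =>
    rw [Function.iterate_succ_apply', ih]
    funext x
    have h := risingFac_sub_risingFac_sub_one x (n - k)
    rw [fwdDiff, Nat.descFactorial_succ, ← sub_eq_add_neg, Nat.sub_add_eq, pow_succ]
    push_cast
    linear_combination (-(-1) ^ k * (n.descFactorial k : ℝ)) * h

/-- The iterated backward difference of a rising factorial. -/
theorem sum_choose_mul_risingFac_sub (x : ℝ) (n k : ℕ) :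
    ∑ i ∈ Finset.range (k + 1), (-1 : ℝ) ^ i * (k.choose i : ℝ) * risingFac (x - i) n 1 =
      (k.factorial : ℝ) * (n.choose k : ℝ) * risingFac x (n - k) 1 := by
  have h := congrFun (fwdDiff_iter_risingFac n k) x
  rw [fwdDiff_iter_eq_sum_shift] at h
  have hk : ((-1 : ℝ) ^ k) * (-1) ^ k = 1 := by rw [← mul_pow]; simp
  rw [← Nat.cast_mul, ← Nat.descFactorial_eq_factorial_mul_choose]
  calc _ = (-1) ^ k * ((-1) ^ k * (n.descFactorial k : ℝ) * risingFac x (n - k) 1) := by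
        rw [← h, Finset.mul_sum]
        refine Finset.sum_congr rfl fun i hi => ?_
        obtain ⟨d, rfl⟩ := Nat.exists_eq_add_of_le (Finset.mem_range_succ_iff.mp hi)
        have hd : ((-1 : ℝ) ^ d) * (-1) ^ d = 1 := by rw [← mul_pow]; simp
        rw [Nat.add_sub_cancel_left, zsmul_eq_mul, nsmul_eq_mul, mul_neg_one, ← sub_eq_add_neg]
        push_cast
        rw [pow_add]
        linear_combination (-(-1) ^ i * ((i + d).choose i : ℝ) * risingFac (x - i) n 1) * hd
    _ = _ := by linear_combination ((n.descFactorial k : ℝ) * risingFac x (n - k) 1) * hk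

theorem exists_risingFac_mul_eq_sum (α : ℝ) (m : ℕ) :
    ∃ c : ℕ → ℝ, ∀ t : ℝ,
      risingFac (α * t) m 1 = ∑ l ∈ Finset.range (m + 1), c l * risingFac t l 1 := by
  induction m with
  | zero => exact ⟨fun _ => 1, fun t => by simp [risingFac_zero_right]⟩
  | succ m ih =>
    obtain ⟨c, hc⟩ := ih
    refine ⟨fun l => (if l = 0 then 0 else α * c (l - 1)) +
      (if l ≤ m then (m - α * l) * c l else 0), fun t => ?_⟩
    simp only [add_mul, Finset.sum_add_distrib]
    rw [Finset.sum_range_succ', Finset.sum_range_succ _ (m + 1), risingFac_succ, hc,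
      Finset.sum_mul]
    simp only [Nat.add_eq_zero_iff, one_ne_zero, and_false, if_false, if_true, Nat.add_sub_cancel,
      zero_mul, add_zero, Nat.not_succ_le_self]
    rw [← Finset.sum_add_distrib]
    refine Finset.sum_congr rfl fun l hl => ?_
    rw [if_pos (Finset.mem_range_succ_iff.mp hl), risingFac_succ]
    ring

theorem ncGenFacCoeff_eq_sum_of_expansion {α : ℝ} {m : ℕ} {c : ℕ → ℝ}
    (hc : ∀ t : ℝ,
      risingFac (α * t) m 1 = ∑ l ∈ Finset.range (m + 1), c l * risingFac t l 1)
    (k : ℕ) (b : ℝ) :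
    ncGenFacCoeff m k α (-(α * b)) =
      ∑ l ∈ Finset.range (m + 1), c l * ((l.choose k : ℝ) * risingFac b (l - k) 1) := by
  have hk : (k.factorial : ℝ) ≠ 0 := by positivity
  have harg (i : ℕ) : -(i : ℝ) * α - -(α * b) = α * (b - i) := by ring
  simp only [ncGenFacCoeff, harg, hc, Finset.mul_sum]
  rw [Finset.sum_comm]
  refine Finset.sum_congr rfl fun l _ => ?_
  have h := sum_choose_mul_risingFac_sub b l k
  calc _ = 1 / (k.factorial : ℝ) * c l * ∑ i ∈ Finset.range (k + 1),
        (-1 : ℝ) ^ i * (k.choose i : ℝ) * risingFac (b - i) l 1 := by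
        rw [Finset.mul_sum]
        exact Finset.sum_congr rfl fun i _ => by ring
    _ = _ := by rw [h]; field_simp

theorem ncGenFacCoeff_zero_right {m : ℕ} (hm : m ≠ 0) (k : ℕ) (α : ℝ) :
    ncGenFacCoeff m k α 0 = genFacCoeff m k α := by
  unfold ncGenFacCoeff genFacCoeff
  rw [Finset.range_eq_Ico, Finset.sum_eq_sum_Ico_succ_bot (Nat.succ_pos k)]
  simp only [sub_zero, Nat.cast_zero, neg_zero, zero_mul, risingFac_zero_left hm, mul_zero,
    zero_add]
  rfl

/-- Expansion of non-central generalized factorial coefficients in central ones. -/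
theorem ncGenFacCoeff_eq_sum_genFacCoeff {m : ℕ} (hm : m ≠ 0) (k : ℕ) (α b : ℝ) :
    ncGenFacCoeff m k α (-(α * b)) = ∑ l ∈ Finset.Icc 1 m,
      genFacCoeff m l α * ((l.choose k : ℝ) * risingFac b (l - k) 1) := by
  obtain ⟨c, hc⟩ := exists_risingFac_mul_eq_sum α m
  have hcoeff : ∀ l ∈ Finset.range (m + 1), c l = genFacCoeff m l α := by
    intro l hl
    have h := ncGenFacCoeff_eq_sum_of_expansion hc l 0
    rw [mul_zero, neg_zero, ncGenFacCoeff_zero_right hm, Finset.sum_eq_single_of_mem l hl] at h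
    · simpa [risingFac_zero_right] using h.symm
    · intro i _ hil
      rcases lt_or_gt_of_ne hil with hlt | hlt
      · simp [Nat.choose_eq_zero_of_lt hlt]
      · simp [risingFac_zero_left (Nat.sub_ne_zero_of_lt hlt)]
  rw [ncGenFacCoeff_eq_sum_of_expansion hc,
    Finset.sum_congr rfl fun l hl => by rw [hcoeff l hl],
    Finset.range_eq_Ico, Finset.sum_eq_sum_Ico_succ_bot (Nat.succ_pos m)]
  simp only [genFacCoeff, Finset.Icc_eq_empty_of_lt zero_lt_one, Finset.sum_empty, mul_zero,
    zero_mul, zero_add]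
  rfl

theorem stmt13 (α θ : ℝ) (hα : α ∈ Set.Ioo (0 : ℝ) 1) (hθ : -α < θ)
    (n j m : ℕ) (hm : 1 ≤ m) (hj : 1 ≤ j) (hjn : j ≤ n)
    -- posterior distribution of the number of new blocks in `m` additional samples
    (p : ℕ → ℝ)
    (hp : ∀ k, p k = risingFac (θ / α + j) k 1 / risingFac (θ + n) m 1 *
      ncGenFacCoeff m k α (-(n : ℝ) + j * α))
    -- distribution of the number of blocks of a sample of size `m` from `PD(α, θ+n)`
    (q : ℕ → ℝ)
    (hq : ∀ l, q l = risingFac (θ + n) l α / risingFac (θ + n) m 1 *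
      genFacCoeff m l α / α ^ l) :
    ∀ k ≤ m, p k = ∑ l ∈ Finset.Icc 1 m, q l * (Nat.choose l k : ℝ) *
      betaFn (θ / α + j + k) ((n : ℝ) / α - j + l - k) / betaFn (θ / α + j) ((n : ℝ) / α - j) := by
  intro k _
  obtain ⟨hα, hα1⟩ := hα
  have hα' : α ≠ 0 := hα.ne'
  have hj' : (1 : ℝ) ≤ j := by exact_mod_cast hj
  have hjn' : (j : ℝ) ≤ n := by exact_mod_cast hjn
  have ha : 0 < θ / α + j := by
    have : -1 < θ / α := by rw [lt_div_iff₀ hα]; linarith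
    linarith
  have hb : 0 < (n : ℝ) / α - j := by
    have : (n : ℝ) < n / α := by rw [lt_div_iff₀ hα]; nlinarith
    linarith
  have hr : -(n : ℝ) + j * α = -(α * ((n : ℝ) / α - j)) := by field_simp; ring
  rw [hp, hr, ncGenFacCoeff_eq_sum_genFacCoeff (Nat.one_le_iff_ne_zero.mp hm), Finset.mul_sum]
  refine Finset.sum_congr rfl fun l _ => ?_
  rcases lt_or_ge l k with hlk | hkl
  · simp [Nat.choose_eq_zero_of_lt hlk]
  obtain ⟨d, rfl⟩ := Nat.exists_eq_add_of_le hkl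
  have hd : (n : ℝ) / α - j + ((k + d : ℕ) : ℝ) - k = n / α - j + d := by push_cast; ring
  have hscale : risingFac (θ + n) (k + d) α =
      α ^ (k + d) * risingFac (θ / α + j + (n / α - j)) (k + d) 1 := by
    rw [← risingFac_mul_left, mul_one]
    congr 1
    field_simp
    ring
  have hpos := (risingFac_one_pos (add_pos ha hb) (k + d)).ne'
  rw [mul_div_assoc, hd, betaFn_add_natCast_div ha hb, hq, hscale, Nat.add_sub_cancel_left]
  generalize risingFac (θ / α + j + (n / α - j)) (k + d) 1 = R at hpos
  field_simp
end
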